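/- Let S be a quasi-orthodox quasi completely regular semiring. Then H*⁺ ∩ 𝒴 = ρ, where ρ is the least completely regular semiring congruence on S. -/

import Mathlib

/-- A "semiring" in the sense of the paper: both reducts are semigroups
(no commutativity, no identities) and multiplication distributes over
addition on both sides. -/
class PSemiring (S : Type*) extends AddSemigroup S, Semigroup S where
  left_distrib : ∀ a b c : S, a * (b + c) = a * b + a * c
  right_distrib : ∀ a b c : S, (a + b) * c = a * c + b * c

namespace PSemiring

variable {S : Type*} [PSemiring S]

/-- `nmul n a` is the `(n+1)`-fold sum `a + ⋯ + a`; thus the positive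
multiple `m·a` of the paper is `nmul (m-1) a`. -/
def nmul : ℕ → S → S
  | 0, a => a
  | n + 1, a => nmul n a + a

/-- `a` is additively regular. -/
def AddRegular (a : S) : Prop := ∃ x, a + x + a = a

/-- `a` is a completely regular element. -/
def CompletelyRegularElem (a : S) : Prop :=
  ∃ x, a = a + x + a ∧ a + x = x + a ∧ a * (a + x) = a + x

/-- `S` is a quasi completely regular semiring. -/
def QuasiCompletelyRegular (S : Type*) [PSemiring S] : Prop :=
  ∀ a : S, ∃ n : ℕ, CompletelyRegularElem (nmul n a)

/-- `S` is a completely regular semiring. -/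
def CompletelyRegularSemiring (S : Type*) [PSemiring S] : Prop :=
  ∀ a : S, CompletelyRegularElem a

/-- `e` is an additive idempotent (i.e. `e ∈ E⁺(S)`). -/
def AddIdem (e : S) : Prop := e + e = e

/-- `V⁺(a)`, the set of additive inverses of `a`. -/
def Vplus (a : S) : Set S := {x | a + x + a = a ∧ x + a + x = x}

/-- `{a} ∪ (S + a)`. -/
def lset (a : S) : Set S := insert a {x | ∃ s, x = s + a}

/-- `{a} ∪ (a + S)`. -/
def rset (a : S) : Set S := insert a {x | ∃ s, x = a + s}

/-- `{a} ∪ (S + a) ∪ (a + S) ∪ (S + a + S)`. -/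
def jset (a : S) : Set S :=
  insert a ({x | ∃ s, x = s + a} ∪ {x | ∃ s, x = a + s} ∪ {x | ∃ s t, x = s + a + t})

/-- Green's relation `L⁺` on the additive reduct. -/
def GreenL (a b : S) : Prop := lset a = lset b

/-- Green's relation `R⁺` on the additive reduct. -/
def GreenR (a b : S) : Prop := rset a = rset b

/-- Green's relation `J⁺` on the additive reduct. -/
def GreenJ (a b : S) : Prop := jset a = jset b

/-- `n` is the least index such that the `(n+1)`-fold sum of `a` is additively
regular, i.e. `(n+1)·a` is the least additively regular positive multiple. -/
def LeastReg (a : S) (n : ℕ) : Prop :=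
  AddRegular (nmul n a) ∧ ∀ m < n, ¬ AddRegular (nmul m a)

/-- The relation `L*⁺`. -/
def LStar (a b : S) : Prop :=
  ∃ p q, LeastReg a p ∧ LeastReg b q ∧ GreenL (nmul p a) (nmul q b)

/-- The relation `R*⁺`. -/
def RStar (a b : S) : Prop :=
  ∃ p q, LeastReg a p ∧ LeastReg b q ∧ GreenR (nmul p a) (nmul q b)

/-- The relation `J*⁺`. -/
def JStar (a b : S) : Prop :=
  ∃ p q, LeastReg a p ∧ LeastReg b q ∧ GreenJ (nmul p a) (nmul q b)

/-- `H*⁺ = L*⁺ ∩ R*⁺`. -/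
def HStar (a b : S) : Prop := LStar a b ∧ RStar a b

/-- `D*⁺ = L*⁺ ∘ R*⁺` (relational composition). -/
def DStar (a b : S) : Prop := ∃ c, LStar a c ∧ RStar c b

/-- `z = 0_a`: `z = na + x` where `n` is the least positive integer with `na`
completely regular and `x` is the (unique) element with `na = na+x+na`,
`x = x+na+x` and `na+x = x+na`. -/
def IsZeroOf (a z : S) : Prop :=
  ∃ n x, (CompletelyRegularElem (nmul n a) ∧
      ∀ m < n, ¬ CompletelyRegularElem (nmul m a)) ∧
    nmul n a = nmul n a + x + nmul n a ∧ x = x + nmul n a + x ∧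
    nmul n a + x = x + nmul n a ∧ z = nmul n a + x

/-- The relation `𝒴`, relative to a choice `z` of the map `a ↦ 0_a`. -/
def Yrel (z : S → S) (a b : S) : Prop := Vplus (a + z a) = Vplus (b + z b)

/-- A (semiring) congruence. -/
structure IsCong (r : S → S → Prop) : Prop where
  refl : ∀ a, r a a
  symm : ∀ {a b}, r a b → r b a
  trans : ∀ {a b c}, r a b → r b c → r a c
  addl : ∀ (c : S) {a b}, r a b → r (c + a) (c + b)
  addr : ∀ (c : S) {a b}, r a b → r (a + c) (b + c)
  mull : ∀ (c : S) {a b}, r a b → r (c * a) (c * b)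
  mulr : ∀ (c : S) {a b}, r a b → r (a * c) (b * c)

/-- `r` is a b-lattice congruence: `S/r` is a b-lattice. -/
def IsBLatticeCong (r : S → S → Prop) : Prop :=
  IsCong r ∧ (∀ a : S, r (a * a) a) ∧ (∀ a : S, r (a + a) a) ∧
    ∀ a b : S, r (a + b) (b + a)

/-- `r` is the least b-lattice congruence. -/
def IsLeastBLatticeCong (r : S → S → Prop) : Prop :=
  IsBLatticeCong r ∧ ∀ r', IsBLatticeCong r' → ∀ a b, r a b → r' a b

/-- `r` is a skew-ring congruence: `S/r` is a semiring whose additive reduct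
is a group (expressed by solvability of both translation equations). -/
def IsSkewRingCong (r : S → S → Prop) : Prop :=
  IsCong r ∧ ∀ a b : S, (∃ x, r (a + x) b) ∧ ∃ y, r (y + a) b

/-- `r` is the least skew-ring congruence. -/
def IsLeastSkewRingCong (r : S → S → Prop) : Prop :=
  IsSkewRingCong r ∧ ∀ r', IsSkewRingCong r' → ∀ a b, r a b → r' a b

/-- `η` is a b-lattice-of-skew-rings congruence: `S/η` admits a congruence `ξ`
(given here as a congruence on `S` containing `η`) such that `(S/η)/ξ` is a
b-lattice and every `ξ`-class of `S/η` is a subsemiring whose additive reduct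
is a group. -/
def IsBLSRCong (η : S → S → Prop) : Prop :=
  IsCong η ∧ ∃ ξ : S → S → Prop, IsCong ξ ∧ (∀ a b, η a b → ξ a b) ∧
    (∀ a : S, ξ (a * a) a) ∧ (∀ a : S, ξ (a + a) a) ∧
    (∀ a b : S, ξ (a + b) (b + a)) ∧
    (∀ a b, ξ a b → ξ (a + b) a ∧ ξ (a * b) a) ∧
    ∀ a b, ξ a b → (∃ x, ξ x a ∧ η (a + x) b) ∧ ∃ y, ξ y a ∧ η (y + a) b

/-- `ν` is the least b-lattice-of-skew-rings congruence. -/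
def IsLeastBLSRCong (ν : S → S → Prop) : Prop :=
  IsBLSRCong ν ∧ ∀ η, IsBLSRCong η → ∀ a b, ν a b → η a b

/-- `r` is a completely regular semiring congruence: `S/r` is completely
regular. -/
def IsCRCong (r : S → S → Prop) : Prop :=
  IsCong r ∧ ∀ a : S, ∃ x, r a (a + x + a) ∧ r (a + x) (x + a) ∧
    r (a * (a + x)) (a + x)

/-- `ρ` is the least completely regular semiring congruence. -/
def IsLeastCRCong (r : S → S → Prop) : Prop :=
  IsCRCong r ∧ ∀ r', IsCRCong r' → ∀ a b, r a b → r' a b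

/-- `S` is quasi-orthodox. -/
def QuasiOrthodox (S : Type*) [PSemiring S] : Prop :=
  ∀ e f : S, AddIdem e → AddIdem f →
    ∃ n : ℕ, nmul n (e + f) = nmul (n + 1) (e + f)

/-- `S` is a completely Archimedean semiring. -/
def CompletelyArchimedean (S : Type*) [PSemiring S] : Prop :=
  QuasiCompletelyRegular S ∧ ∀ a b : S, JStar a b

/-- `r` is the least congruence containing the relation `τ`. -/
def IsLeastCongContaining (τ r : S → S → Prop) : Prop :=
  IsCong r ∧ (∀ a b, τ a b → r a b) ∧
    ∀ r', IsCong r' → (∀ a b, τ a b → r' a b) → ∀ a b, r a b → r' a b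

/-- `r` is a generalized additive idempotent pure congruence (purity part). -/
def GenAddIdemPure (r : S → S → Prop) : Prop :=
  ∀ a e : S, AddIdem e → r a e → ∃ n : ℕ, nmul n a = nmul (n + 1) a

/-- `τ^e`: `a = x + c + y`, `b = x + d + y` for some `(c,d) ∈ τ`, where each of
`x`, `y` may also be absent (i.e. `x, y ∈ S⁰`). -/
def relE (τ : S → S → Prop) (a b : S) : Prop :=
  ∃ c d, τ c d ∧ ((a = c ∧ b = d) ∨ (∃ x, a = x + c ∧ b = x + d) ∨
    (∃ y, a = c + y ∧ b = d + y) ∨ ∃ x y, a = x + c + y ∧ b = x + d + y)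

/-- `τ^♮`: the transitive closure of `(τ ∪ τ⁻¹ ∪ ε)^e`. -/
def natClosure (τ : S → S → Prop) : S → S → Prop :=
  Relation.TransGen (relE (fun a b => τ a b ∨ τ b a ∨ a = b))

end PSemiring

open PSemiring

namespace PSemiring

variable {S : Type*} [PSemiring S]

/-- `a` lies in the maximal additive subgroup with identity `g`. -/
structure InGroup (g a : S) : Prop where
  left_id : g + a = a
  right_id : a + g = a
  right_inv : ∃ x, a + x = g
  left_inv : ∃ y, y + a = g

theorem InGroup.addIdem {g a : S} (h : InGroup g a) : g + g = g := by
  obtain ⟨x, hx⟩ := h.right_inv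
  conv_lhs => rw [← hx, ← add_assoc, hx, h.left_id]
  exact hx

theorem InGroup.unique {g k a : S} (h : InGroup g a) (h' : InGroup k a) : g = k := by
  obtain ⟨x, hx⟩ := h.right_inv
  obtain ⟨y, hy⟩ := h'.left_inv
  have h₁ : k + g = g := by rw [← hx, ← add_assoc, h'.left_id]
  have h₂ : k + g = k := by rw [← hy, add_assoc, h.right_id]
  exact h₁.symm.trans h₂

theorem InGroup.add {g a b : S} (ha : InGroup g a) (hb : InGroup g b) : InGroup g (a + b) := by
  refine ⟨by rw [← add_assoc, ha.left_id], by rw [add_assoc, hb.right_id], ?_, ?_⟩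
  · obtain ⟨x, hx⟩ := ha.right_inv
    obtain ⟨y, hy⟩ := hb.right_inv
    refine ⟨y + x, ?_⟩
    rw [add_assoc, ← add_assoc b, hy, ← add_assoc, ha.right_id, hx]
  · obtain ⟨x, hx⟩ := ha.left_inv
    obtain ⟨y, hy⟩ := hb.left_inv
    refine ⟨y + x, ?_⟩
    rw [add_assoc, ← add_assoc x, hx, hb.left_id, hy]

theorem InGroup.nmul {g a : S} (h : InGroup g a) (n : ℕ) : InGroup g (nmul n a) := by
  induction n with
  | zero => exact h
  | succ n ih => exact ih.add h

theorem add_nmul (n : ℕ) (a : S) : a + nmul n a = nmul n a + a := by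
  induction n with
  | zero => rfl
  | succ n ih => simp only [nmul]; rw [← add_assoc, ih]

theorem nmul_nmul (m n : ℕ) (a : S) : ∃ k, nmul m (nmul n a) = nmul k a ∧
    nmul n (nmul m a) = nmul k a := by
  have key : ∀ m n : ℕ, nmul m (nmul n a) = nmul (m * n + m + n) a := by
    have hadd : ∀ p q : ℕ, nmul p a + nmul q a = nmul (p + q + 1) a := by
      intro p q
      induction q with
      | zero => rfl
      | succ q ih => simp only [nmul]; rw [← add_assoc, ih]; rfl
    intro m n
    induction m with
    | zero => simp [nmul]
    | succ m ih => simp only [nmul]; rw [ih, hadd]; congr 1; ring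
  exact ⟨_, key m n, by rw [key]; congr 1; ring⟩

theorem nmul_mul (n : ℕ) (a b : S) : nmul n a * b = nmul n (a * b) := by
  induction n with
  | zero => rfl
  | succ n ih => simp only [nmul]; rw [right_distrib, ih]

theorem mul_nmul (n : ℕ) (a b : S) : a * nmul n b = nmul n (a * b) := by
  induction n with
  | zero => rfl
  | succ n ih => simp only [nmul]; rw [left_distrib, ih]

theorem nmul_of_addIdem {e : S} (h : e + e = e) (n : ℕ) : nmul n e = e := by
  induction n with
  | zero => rfl
  | succ n ih => simp only [nmul]; rw [ih, h]

theorem addIdem_mul {e : S} (h : e + e = e) (a : S) : e * a + e * a = e * a := by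
  rw [← right_distrib, h]

theorem mul_addIdem {e : S} (h : e + e = e) (a : S) : a * e + a * e = a * e := by
  rw [← left_distrib, h]

/-- In a quasi completely regular semiring, additive idempotents are multiplicative idempotents. -/
theorem QuasiCompletelyRegular.mul_self (hS : QuasiCompletelyRegular S) {e : S}
    (h : e + e = e) : e * e = e := by
  obtain ⟨n, x, h₁, h₂, h₃⟩ := hS e
  rw [nmul_of_addIdem h] at h₁ h₂ h₃
  have : e + x = e := by
    conv_rhs => rw [h₁, h₂, add_assoc, h, ← h₂]
  rwa [this] at h₃

theorem InGroup.mul_addIdem {g a f : S} (h : InGroup g a) (hf : f + f = f) : a * f = g * f := by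
  obtain ⟨x, hx⟩ := h.right_inv
  have h₁ : a * f + g * f = a * f := by rw [← right_distrib, h.right_id]
  have h₂ : a * f + x * f = g * f := by rw [← right_distrib, hx]
  rw [← h₁, ← h₂, ← add_assoc, PSemiring.mul_addIdem hf]

theorem InGroup.addIdem_mul {g a f : S} (h : InGroup g a) (hf : f + f = f) : f * a = f * g := by
  obtain ⟨x, hx⟩ := h.right_inv
  have h₁ : f * a + f * g = f * a := by rw [← left_distrib, h.right_id]
  have h₂ : f * a + f * x = f * g := by rw [← left_distrib, hx]
  rw [← h₁, ← h₂, ← add_assoc, PSemiring.addIdem_mul hf]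

theorem inGroup_of_eq_add {c s t : S} (hs : c = c + c + s) (ht : c = t + c + c) :
    InGroup (c + s) c := by
  have h : c + s = t + c := by
    calc c + s = t + c + c + s := by rw [← ht]
      _ = t + (c + c + s) := by simp only [add_assoc]
      _ = t + c := by rw [← hs]
  exact ⟨by rw [h, ← ht], by rw [← add_assoc, ← hs], ⟨s, rfl⟩, ⟨t, h.symm⟩⟩

/-- In a quasi completely regular semiring, additively regular elements lie in additive
subgroups. -/
theorem AddRegular.exists_inGroup (hS : QuasiCompletelyRegular S) {a : S} (ha : AddRegular a) :
    ∃ g, InGroup g a := by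
  obtain ⟨x, hax, hxa⟩ : ∃ x, a + x + a = a ∧ x + a + x = x := by
    obtain ⟨x, hx⟩ := ha
    exact ⟨x + a + x, by grind, by grind⟩
  have he : (a + x) + (a + x) = a + x := by grind
  have hf : (x + a) + (x + a) = x + a := by grind
  have hee := hS.mul_self he
  have hff := hS.mul_self hf
  have hea : (a + x) * a = a * a + x * a := right_distrib ..
  have hfa : (x + a) * a = x * a + a * a := right_distrib ..
  have hae2 := PSemiring.mul_addIdem he a
  have haf2 := PSemiring.mul_addIdem hf a
  have e₁ : a + x = (a + x) * a + (a + x) * x := by rw [← left_distrib, hee]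
  have e₂ : a + x = a * (a + x) + x * (a + x) := by rw [← right_distrib, hee]
  have f₁ : x + a = (x + a) * x + (x + a) * a := by rw [← left_distrib, hff]
  have f₂ : x + a = x * (x + a) + a * (x + a) := by rw [← right_distrib, hff]
  have e₃ : (a + x) * a + (a + x) * x + (a + x) * a = (a + x) * a := by
    rw [← left_distrib, ← left_distrib, hax]
  have f₃ : (x + a) * a + (x + a) * x + (x + a) * a = (x + a) * a := by
    rw [← left_distrib, ← left_distrib, hax]
  have hec : (a + x) + a * a = a * a := by
    have h : a * a = (a + x) * a + a * a := by rw [← right_distrib, hax]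
    calc (a + x) + a * a = (a + x) + ((a + x) * a + a * a) := by rw [← h]
      _ = ((a + x) * a + (a + x) * x) + ((a + x) * a + a * a) := by rw [← e₁]
      _ = ((a + x) * a + (a + x) * x + (a + x) * a) + a * a := by simp only [add_assoc]
      _ = a * a := by rw [e₃, ← h]
  have hcf : a * a + (x + a) = a * a := by
    have h : a * a = a * a + (x + a) * a := by rw [← right_distrib, ← add_assoc, hax]
    calc a * a + (x + a) = (a * a + (x + a) * a) + (x + a) := by rw [← h]
      _ = (a * a + (x + a) * a) + ((x + a) * x + (x + a) * a) := by rw [← f₁]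
      _ = a * a + ((x + a) * a + (x + a) * x + (x + a) * a) := by simp only [add_assoc]
      _ = a * a := by rw [f₃, ← h]
  have hae3 : a * (a + x) = (a * a + a * a) + (a * x + a * x) := by
    rw [← hae2, ← right_distrib, left_distrib, right_distrib, right_distrib]
  have haf3 : a * (x + a) = (a * x + a * x) + (a * a + a * a) := by
    rw [← haf2, ← right_distrib, left_distrib, right_distrib, right_distrib]
  obtain ⟨s, hs⟩ : ∃ s, a * a = a * a + a * a + s :=
    ⟨a * x + a * x + x * (a + x) + a * a, by
      conv_lhs => rw [← hec, e₂, hae3]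
      simp only [add_assoc]⟩
  obtain ⟨t, ht⟩ : ∃ t, a * a = t + a * a + a * a :=
    ⟨a * a + x * (x + a) + (a * x + a * x), by
      conv_lhs => rw [← hcf, f₂, haf3]
      simp only [add_assoc]⟩
  have hk := inGroup_of_eq_add hs ht
  obtain ⟨u, hu⟩ : ∃ u, a = a * a + u :=
    ⟨x * a + (a + x) * x + a, by
      conv_lhs => rw [← hax, e₁, hea]
      simp only [add_assoc]⟩
  obtain ⟨v, hv⟩ : ∃ v, a = v + a * a :=
    ⟨a + (x + a) * x + x * a, by
      conv_lhs => rw [← hax, add_assoc, f₁, hfa]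
      simp only [add_assoc]⟩
  refine ⟨a * a + s, ?_, ?_, ⟨x + a * a + s, ?_⟩, ?_⟩
  · exact (congrArg (a * a + s + ·) hu).trans (by rw [← add_assoc, hk.left_id, ← hu])
  · exact (congrArg (· + (a * a + s)) hv).trans (by rw [add_assoc, hk.right_id, ← hv])
  · rw [← add_assoc, ← add_assoc, hec]
  · obtain ⟨y, hy⟩ := hk.left_inv
    exact ⟨y + a * a + x, by rw [add_assoc, add_assoc, hcf, hy]⟩

/-- `g` is the identity of the additive subgroup containing some positive multiple of `a`. -/
def IsGroupZero (a g : S) : Prop := ∃ n, InGroup g (nmul n a)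

theorem IsZeroOf.isGroupZero {a g : S} (h : IsZeroOf a g) : IsGroupZero a g := by
  obtain ⟨n, x, -, h₁, -, h₂, rfl⟩ := h
  exact ⟨n, h₁.symm, by rw [h₂, ← add_assoc, ← h₁], ⟨x, rfl⟩, ⟨x, h₂.symm⟩⟩

theorem InGroup.isGroupZero {a g : S} (h : InGroup g a) : IsGroupZero a g := ⟨0, h⟩

theorem IsGroupZero.unique {a g k : S} (h : IsGroupZero a g) (h' : IsGroupZero a k) : g = k := by
  obtain ⟨n, hn⟩ := h
  obtain ⟨m, hm⟩ := h'
  obtain ⟨p, h₁, h₂⟩ := nmul_nmul m n a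
  have hn' := hn.nmul m
  have hm' := hm.nmul n
  rw [h₁] at hn'
  rw [h₂] at hm'
  exact hn'.unique hm'

theorem IsGroupZero.addIdem {a g : S} (h : IsGroupZero a g) : g + g = g := by
  obtain ⟨n, hn⟩ := h
  exact hn.addIdem

theorem IsGroupZero.add_comm {a g : S} (h : IsGroupZero a g) : g + a = a + g := by
  obtain ⟨n, hn⟩ := h
  have hc := add_nmul n a
  obtain ⟨x, hx⟩ := hn.right_inv
  obtain ⟨y, hy⟩ := hn.left_inv
  have h₁ : g + a + g = a + g := by
    calc g + a + g = g + a + (nmul n a + x) := by rw [hx]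
      _ = g + (a + nmul n a) + x := by simp only [add_assoc]
      _ = g + nmul n a + a + x := by rw [hc]; simp only [add_assoc]
      _ = a + (nmul n a + x) := by rw [hn.left_id, ← hc, add_assoc]
      _ = a + g := by rw [hx]
  have h₂ : g + a + g = g + a := by
    calc g + a + g = (y + nmul n a) + a + g := by rw [hy]
      _ = y + (nmul n a + a) + g := by simp only [add_assoc]
      _ = y + (a + (nmul n a + g)) := by rw [← hc]; simp only [add_assoc]
      _ = y + nmul n a + a := by rw [hn.right_id, hc, add_assoc]
      _ = g + a := by rw [hy]
  rw [← h₂, h₁]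

theorem IsGroupZero.inGroup {a g : S} (h : IsGroupZero a g) : InGroup g (a + g) := by
  have hg := h.addIdem
  have hc := h.add_comm
  obtain ⟨n, hn⟩ := h
  obtain ⟨x, hx⟩ := (hn.nmul 1).right_inv
  obtain ⟨y, hy⟩ := (hn.nmul 1).left_inv
  obtain ⟨s, hs, hs'⟩ : ∃ s, nmul 1 (nmul n a) = a + s ∧ nmul 1 (nmul n a) = s + a := by
    cases n with
    | zero => exact ⟨a, rfl, rfl⟩
    | succ n =>
      refine ⟨nmul n a + nmul (n + 1) a, ?_, ?_⟩
      · simp only [nmul]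
        rw [← add_nmul n a]
        simp only [add_assoc]
      · simp only [nmul]
        rw [add_assoc, add_assoc, add_assoc, ← add_assoc a, add_nmul n a, add_assoc]
  refine ⟨?_, by rw [add_assoc, hg], ⟨s + x, ?_⟩, ⟨y + s, ?_⟩⟩
  · rw [← add_assoc, hc, add_assoc, hg]
  · rw [← hc, add_assoc, ← add_assoc a, ← hs, hx, hg]
  · rw [← add_assoc, add_assoc y, ← hs', hy, hg]

theorem IsGroupZero.mul_addIdem {a g f : S} (h : IsGroupZero a g) (hf : f + f = f) :
    a * f = g * f := by
  obtain ⟨n, hn⟩ := h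
  rw [← hn.mul_addIdem hf, nmul_mul, nmul_of_addIdem (PSemiring.mul_addIdem hf a)]

theorem IsGroupZero.addIdem_mul {a g f : S} (h : IsGroupZero a g) (hf : f + f = f) :
    f * a = f * g := by
  obtain ⟨n, hn⟩ := h
  rw [← hn.addIdem_mul hf, mul_nmul, nmul_of_addIdem (PSemiring.addIdem_mul hf a)]

theorem IsGroupZero.mul {a b g h : S} (ha : IsGroupZero a g) (hb : IsGroupZero b h) :
    IsGroupZero (a * b) (g * h) := by
  rw [← hb.addIdem_mul ha.addIdem]
  obtain ⟨n, hn⟩ := ha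
  obtain ⟨x, hx⟩ := hn.right_inv
  obtain ⟨y, hy⟩ := hn.left_inv
  refine ⟨n, ?_⟩
  rw [← nmul_mul]
  exact ⟨by rw [← right_distrib, hn.left_id], by rw [← right_distrib, hn.right_id],
    ⟨x * b, by rw [← right_distrib, hx]⟩, ⟨y * b, by rw [← right_distrib, hy]⟩⟩

theorem IsGroupZero.add_eq (hS : QuasiCompletelyRegular S) {a b g h f : S}
    (ha : IsGroupZero a g) (hb : IsGroupZero b h) (hf : IsGroupZero (a + b) f) :
    f = g + g * h + (h * g + h) := by
  have hg := ha.addIdem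
  have hh := hb.addIdem
  have hff := hf.addIdem
  have h₁ : g * f = g + g * h := by
    rw [← hf.addIdem_mul hg, left_distrib, ha.addIdem_mul hg, hb.addIdem_mul hg, hS.mul_self hg]
  have h₂ : h * f = h * g + h := by
    rw [← hf.addIdem_mul hh, left_distrib, ha.addIdem_mul hh, hb.addIdem_mul hh, hS.mul_self hh]
  rw [← h₁, ← h₂, ← ha.mul_addIdem hff, ← hb.mul_addIdem hff, ← right_distrib,
    hf.mul_addIdem hff, hS.mul_self hff]

theorem QuasiOrthodox.addIdem_add (hqo : QuasiOrthodox S) {e f k : S} (he : e + e = e)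
    (hf : f + f = f) (hk : InGroup k (e + f)) : (e + f) + (e + f) = e + f := by
  obtain ⟨n, hn⟩ := hqo e f he hf
  obtain ⟨y, hy⟩ := (hk.nmul n).left_inv
  have : e + f = k := by
    rw [← hk.left_id, ← hy, add_assoc]
    exact congrArg (y + ·) hn.symm
  rw [this, hk.addIdem]

/-- The identity of the group of a sum may be inserted between the summands. -/
theorem IsGroupZero.sandwich (hS : QuasiCompletelyRegular S) (hqo : QuasiOrthodox S) {a b f : S}
    (hf : IsGroupZero (a + b) f) : a + b + f = (f + a) + f + (b + f) := by
  have hff := hf.addIdem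
  have huv : (f + a) + (b + f) = a + b + f := by
    rw [add_assoc, ← add_assoc a, ← add_assoc, hf.add_comm, add_assoc, hff]
  have hG : InGroup f ((f + a) + (b + f)) := huv ▸ hf.inGroup
  rw [← huv]
  generalize hu : f + a = u at *
  generalize hv : b + f = v at *
  have hfu : f + u = u := by rw [← hu, ← add_assoc, hff]
  have hvf : v + f = v := by rw [← hv, add_assoc, hff]
  obtain ⟨s, hs⟩ := hG.right_inv
  obtain ⟨t, ht⟩ := hG.left_inv
  obtain ⟨k, hk⟩ := AddRegular.exists_inGroup hS (a := u)
    ⟨v + s, by rw [← add_assoc, hs, hfu]⟩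
  obtain ⟨l, hl⟩ := AddRegular.exists_inGroup hS (a := v)
    ⟨t + u, by rw [add_assoc, add_assoc t, ht, hvf]⟩
  obtain ⟨y, hy⟩ := hk.left_inv
  obtain ⟨y', hy'⟩ := hl.left_inv
  have hkf : k + f = f := by rw [← hs, ← add_assoc, ← add_assoc, hk.left_id]
  have hlf : l + f = l := by rw [← hy', add_assoc, hvf]
  have hkl : k + l + (v + s + u) = k := by
    calc k + l + (v + s + u) = y + (u + (l + v) + s) + u := by
          rw [← hy]; simp only [add_assoc]
      _ = k := by rw [hl.left_id, hs, add_assoc, hfu, hy]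
  obtain ⟨m, hm⟩ := AddRegular.exists_inGroup hS (a := k + l)
    ⟨v + s + u, by rw [hkl, ← add_assoc, hk.addIdem]⟩
  have hd := hqo.addIdem_add hk.addIdem hl.addIdem hm
  have hdf : k + l = f := by
    have h₁ : k + l + f = f := by
      calc k + l + f = k + l + (k + l + (v + s + u) + f) := by rw [hkl, hkf]
        _ = (k + l) + (k + l) + (v + s + u) + f := by simp only [add_assoc]
        _ = f := by rw [hd, hkl, hkf]
    rw [← h₁, add_assoc, hlf]
  rw [← hdf, ← add_assoc, hk.right_id, add_assoc, hl.left_id]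

theorem IsGroupZero.add_right_eq (hS : QuasiCompletelyRegular S) (hqo : QuasiOrthodox S)
    {a b g h f f' : S} (ha : IsGroupZero a g) (hb : IsGroupZero b h)
    (hf : IsGroupZero (a + b) f) (hf' : IsGroupZero ((a + g) + (b + h)) f') :
    (a + b) + f = (a + g) + (b + h) + f' := by
  have e := ha.add_eq hS hb hf
  obtain rfl : f = f' :=
    e.trans (ha.inGroup.isGroupZero.add_eq hS hb.inGroup.isGroupZero hf').symm
  have hgf : g + f = f := by
    rw [e]; simp only [← add_assoc]; rw [ha.addIdem]
  have hfh : f + h = f := by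
    rw [e]; simp only [add_assoc]; rw [hb.addIdem]
  rw [hf.sandwich hS hqo, hf'.sandwich hS hqo]
  have h₁ : f + (a + g) + f = f + a + f := by rw [add_assoc, add_assoc, hgf, ← add_assoc]
  have h₂ : f + (b + h + f) = f + (b + f) := by
    rw [← hb.add_comm, ← add_assoc, ← add_assoc, hfh, add_assoc]
  rw [h₁, add_assoc (f + a) f, ← h₂, ← add_assoc]

theorem IsGroupZero.mul_add_eq {a b g h : S} (ha : IsGroupZero a g) (hb : IsGroupZero b h) :
    a * b + g * h = (a + g) * (b + h) := by
  rw [right_distrib, left_distrib, left_distrib, ha.mul_addIdem hb.addIdem,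
    hb.addIdem_mul ha.addIdem, PSemiring.addIdem_mul ha.addIdem, add_assoc,
    PSemiring.addIdem_mul ha.addIdem]

theorem isCong_add_zero (hS : QuasiCompletelyRegular S) (hqo : QuasiOrthodox S) {z : S → S}
    (hz : ∀ a, IsGroupZero a (z a)) : IsCong fun a b => a + z a = b + z b where
  refl _ := rfl
  symm h := h.symm
  trans h h' := h.trans h'
  addl c a b h := by
    have key := fun a => (hz c).add_right_eq hS hqo (hz a) (hz (c + a)) (hz _)
    change (c + a) + z (c + a) = (c + b) + z (c + b)
    rw [key a, key b, h]
  addr c a b h := by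
    have key := fun a => (hz a).add_right_eq hS hqo (hz c) (hz (a + c)) (hz _)
    change (a + c) + z (a + c) = (b + c) + z (b + c)
    rw [key a, key b, h]
  mull c a b h := by
    have key := fun a => (hz (c * a)).unique ((hz c).mul (hz a))
    change c * a + z (c * a) = c * b + z (c * b)
    rw [key a, key b, (hz c).mul_add_eq (hz a), (hz c).mul_add_eq (hz b), h]
  mulr c a b h := by
    have key := fun a => (hz (a * c)).unique ((hz a).mul (hz c))
    change a * c + z (a * c) = b * c + z (b * c)
    rw [key a, key b, (hz a).mul_add_eq (hz c), (hz b).mul_add_eq (hz c), h]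

theorem InGroup.exists_neg {g a : S} (h : InGroup g a) :
    ∃ y, InGroup g y ∧ a + y = g ∧ y + a = g := by
  obtain ⟨x, hx⟩ := h.right_inv
  obtain ⟨t, ht⟩ := h.left_inv
  have hxt : g + x = t + g := by rw [← ht, add_assoc, hx, ht]
  have hg := h.addIdem
  have h₁ : a + (g + x) = g := by rw [← add_assoc, h.right_id, hx]
  have h₂ : g + x + a = g := by rw [hxt, add_assoc, h.left_id, ht]
  refine ⟨g + x, ⟨by rw [← add_assoc, hg], ?_, ⟨a, h₂⟩, ⟨a, h₁⟩⟩, h₁, h₂⟩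
  rw [hxt, add_assoc, hg]

theorem isCRCong_add_zero (hS : QuasiCompletelyRegular S) (hqo : QuasiOrthodox S) {z : S → S}
    (hz : ∀ a, IsGroupZero a (z a)) : IsCRCong fun a b => a + z a = b + z b := by
  refine ⟨isCong_add_zero hS hqo hz, fun a => ?_⟩
  obtain ⟨y, hy, h₁, h₂⟩ := (hz a).inGroup.exists_neg
  have e₁ : a + y = z a := by rw [← h₁, add_assoc, hy.left_id]
  have e₂ : y + a = z a := by rw [← h₂, ← (hz a).add_comm, ← add_assoc, hy.right_id]
  refine ⟨y, ?_, by rw [e₁, e₂], ?_⟩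
  · change a + z a = a + y + a + z (a + y + a)
    rw [e₁, (hz a).add_comm, (hz _).unique (hz a).inGroup.isGroupZero, (hz a).inGroup.right_id]
  · beta_reduce
    rw [e₁, (hz a).mul_addIdem (hz a).addIdem, hS.mul_self (hz a).addIdem]

theorem IsCRCong.rel_add_zero {r : S → S → Prop} (hr : IsCRCong r) {a g : S}
    (h : IsGroupZero a g) : r a (a + g) := by
  obtain ⟨hc, hcr⟩ := hr
  obtain ⟨x, h₁, h₂, -⟩ := hcr a
  have h₃ : r a (a + a + x) := by
    refine hc.trans h₁ ?_
    rw [add_assoc, add_assoc]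
    exact hc.addl a (hc.symm h₂)
  have key : ∀ n, ∃ s, r a (nmul n a + s) := by
    intro n
    induction n with
    | zero => exact ⟨a + x, by rw [← add_assoc]; exact h₃⟩
    | succ n ih =>
      obtain ⟨s, hs⟩ := ih
      refine ⟨s + x, hc.trans h₃ ?_⟩
      have := hc.addr x (hc.addl a hs)
      rwa [← add_assoc a, add_nmul, add_assoc _ s] at this
  rw [← h.add_comm]
  obtain ⟨n, hn⟩ := h
  obtain ⟨s, hs⟩ := key n
  have := hc.addl g hs
  rw [← add_assoc, hn.left_id] at this
  exact hc.trans hs (hc.symm this)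

theorem lset_subset {a b s : S} (h : a = s + b) : lset a ⊆ lset b := by
  rintro x (rfl | ⟨t, rfl⟩)
  · exact Or.inr ⟨s, h⟩
  · exact Or.inr ⟨t + s, by rw [h, add_assoc]⟩

theorem rset_subset {a b s : S} (h : a = b + s) : rset a ⊆ rset b := by
  rintro x (rfl | ⟨t, rfl⟩)
  · exact Or.inr ⟨s, h⟩
  · exact Or.inr ⟨s + t, by rw [h, add_assoc]⟩

theorem InGroup.greenL {g a : S} (h : InGroup g a) : GreenL a g := by
  obtain ⟨y, hy⟩ := h.left_inv
  exact (lset_subset h.right_id.symm).antisymm (lset_subset hy.symm)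

theorem InGroup.greenR {g a : S} (h : InGroup g a) : GreenR a g := by
  obtain ⟨y, hy⟩ := h.right_inv
  exact (rset_subset h.left_id.symm).antisymm (rset_subset hy.symm)

theorem GreenL.add_eq {g k : S} (h : GreenL g k) (hk : k + k = k) : g + k = g := by
  have : g ∈ lset k := h ▸ Or.inl rfl
  obtain rfl | ⟨s, rfl⟩ := this
  · exact hk
  · rw [add_assoc, hk]

theorem GreenR.add_eq {g k : S} (h : GreenR g k) (hk : k + k = k) : k + g = g := by
  have : g ∈ rset k := h ▸ Or.inl rfl
  obtain rfl | ⟨s, rfl⟩ := this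
  · exact hk
  · rw [← add_assoc, hk]

theorem InGroup.addRegular {g a : S} (h : InGroup g a) : AddRegular a := by
  obtain ⟨x, hx⟩ := h.right_inv
  exact ⟨x, by rw [hx, h.left_id]⟩

theorem LeastReg.inGroup (hS : QuasiCompletelyRegular S) {a g : S} {n : ℕ} (h : LeastReg a n)
    (hg : IsGroupZero a g) : InGroup g (nmul n a) := by
  obtain ⟨k, hk⟩ := AddRegular.exists_inGroup hS h.1
  rwa [hg.unique ⟨n, hk⟩]

theorem IsGroupZero.exists_leastReg {a g : S} (h : IsGroupZero a g) : ∃ n, LeastReg a n := by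
  classical
  obtain ⟨n, hn⟩ := h
  have hex : ∃ n, AddRegular (nmul n a) := ⟨n, hn.addRegular⟩
  exact ⟨Nat.find hex, Nat.find_spec hex, fun m hm => Nat.find_min hex hm⟩

theorem hStar_iff (hS : QuasiCompletelyRegular S) {a b g h : S} (ha : IsGroupZero a g)
    (hb : IsGroupZero b h) : HStar a b ↔ g = h := by
  constructor
  · rintro ⟨⟨p, q, hp, hq, hL⟩, p', q', hp', hq', hR⟩
    have hL' : GreenL g h :=
      ((hp.inGroup hS ha).greenL.symm.trans hL).trans (hq.inGroup hS hb).greenL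
    have hR' : GreenR h g :=
      ((hq'.inGroup hS hb).greenR.symm.trans hR.symm).trans (hp'.inGroup hS ha).greenR
    exact (hL'.add_eq hb.addIdem).symm.trans (hR'.add_eq ha.addIdem)
  · rintro rfl
    obtain ⟨p, hp⟩ := ha.exists_leastReg
    obtain ⟨q, hq⟩ := hb.exists_leastReg
    have hp' := hp.inGroup hS ha
    have hq' := hq.inGroup hS hb
    exact ⟨⟨p, q, hp, hq, hp'.greenL.trans hq'.greenL.symm⟩,
      p, q, hp, hq, hp'.greenR.trans hq'.greenR.symm⟩

theorem InGroup.eq_of_vplus_eq {g a b : S} (ha : InGroup g a) (hb : InGroup g b)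
    (h : Vplus a = Vplus b) : a = b := by
  obtain ⟨y, hy, h₁, h₂⟩ := ha.exists_neg
  have hya : y ∈ Vplus a := ⟨by rw [h₁, ha.left_id], by rw [h₂, hy.left_id]⟩
  rw [h] at hya
  obtain ⟨x, hx⟩ := hb.left_inv
  have hyb : y + b = g := by
    rw [← hy.left_id, ← hx, add_assoc, add_assoc, ← add_assoc b, hya.1]
  rw [← ha.right_id, ← hyb, ← add_assoc, h₁, hb.left_id]

theorem hStar_and_yrel_iff (hS : QuasiCompletelyRegular S) {z : S → S}
    (hz : ∀ a, IsGroupZero a (z a)) (a b : S) :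
    HStar a b ∧ Yrel z a b ↔ a + z a = b + z b := by
  rw [hStar_iff hS (hz a) (hz b)]
  constructor
  · rintro ⟨h, hY⟩
    exact (hz a).inGroup.eq_of_vplus_eq (h ▸ (hz b).inGroup) hY
  · intro h
    exact ⟨(hz a).inGroup.unique (h ▸ (hz b).inGroup), congrArg Vplus h⟩

end PSemiring

/-- In a quasi-orthodox quasi completely regular semiring,
`H*⁺ ∩ 𝒴 = ρ`, the least completely regular semiring congruence. -/
theorem hstar_inter_yrel_eq_rho {S : Type*} [PSemiring S]
    (hS : QuasiCompletelyRegular S) (hqo : QuasiOrthodox S)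
    (z : S → S) (hz : ∀ a, IsZeroOf a (z a))
    (ρ : S → S → Prop) (hρ : IsLeastCRCong ρ) :
    ∀ a b : S, (HStar a b ∧ Yrel z a b) ↔ ρ a b := by
  have hz' := fun a => (hz a).isGroupZero
  intro a b
  rw [hStar_and_yrel_iff hS hz']
  refine ⟨fun h => ?_, hρ.2 _ (isCRCong_add_zero hS hqo hz') a b⟩
  have h₁ := hρ.1.rel_add_zero (hz' a)
  rw [h] at h₁
  exact hρ.1.1.trans h₁ (hρ.1.1.symm (hρ.1.rel_add_zero (hz' b)))
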